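/- Suppose the finite simplicial graph Γ has no SIL. Let ρ̄ : SOut⁰(A_Γ) → Aut(A_Γᵃᵇ) denote the restriction of ρ to SOut⁰(A_Γ), and let Q be the image of ρ̄. Then the short exact sequence 1 → ker ρ̄ → SOut⁰(A_Γ) → Q → 1 splits: there exists a group homomorphism σ : Q → SOut⁰(A_Γ) such that ρ̄ ∘ σ is the identity on Q. -/

import Mathlib

open SimpleGraph

namespace RaagPaper

/-- The star of a vertex: the vertex together with its neighbours. -/
def star {V : Type} (G : SimpleGraph V) (v : V) : Set V := insert v (G.neighborSet v)

/-- Domination: `u ≤ v` iff `lk(u) ⊆ st(v)`. -/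
def Dom {V : Type} (G : SimpleGraph V) (u v : V) : Prop := G.neighborSet u ⊆ star G v

/-- Domination-equivalence of vertices. -/
def EquivDom {V : Type} (G : SimpleGraph V) (u v : V) : Prop := Dom G u v ∧ Dom G v u

/-- The domination-equivalence class of a vertex. -/
def eqClass {V : Type} (G : SimpleGraph V) (x : V) : Set V := {v | EquivDom G v x}

/-- `C` is (the vertex set of) a connected component of the subgraph of `G` induced on `S`. -/
def IsCC {V : Type} (G : SimpleGraph V) (S : Set V) (C : Set V) : Prop :=
  ∃ v : S, C = {w : V | ∃ h : w ∈ S, (G.induce S).Reachable ⟨w, h⟩ v}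

/-- `(x,y|z)` is a separating intersection of links (SIL). -/
def IsSIL {V : Type} (G : SimpleGraph V) (x y z : V) : Prop :=
  x ≠ y ∧ x ≠ z ∧ y ≠ z ∧ ¬ G.Adj x y ∧ ¬ G.Adj x z ∧ ¬ G.Adj y z ∧
  ∀ C : Set V, IsCC G ((G.neighborSet x ∩ G.neighborSet y)ᶜ) C → z ∈ C → x ∉ C ∧ y ∉ C

/-- The graph has no SIL. -/
def HasNoSIL {V : Type} (G : SimpleGraph V) : Prop := ∀ x y z, ¬ IsSIL G x y z

/-- `D` is a (possibly empty) union of connected components of `Γ ∖ st(x)`. -/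
def IsUnionCC {V : Type} (G : SimpleGraph V) (x : V) (D : Set V) : Prop :=
  ∃ 𝒞 : Set (Set V), (∀ C ∈ 𝒞, IsCC G ((star G x)ᶜ) C) ∧ D = ⋃₀ 𝒞


/-- Defining relators of the RAAG: commutators of adjacent vertices. -/
def Rels {V : Type} (G : SimpleGraph V) : Set (FreeGroup V) :=
  {r | ∃ u v : V, G.Adj u v ∧
    r = FreeGroup.of u * FreeGroup.of v * (FreeGroup.of u)⁻¹ * (FreeGroup.of v)⁻¹}

/-- The right-angled Artin group on `G`. -/
abbrev Raag {V : Type} (G : SimpleGraph V) : Type := PresentedGroup (Rels G)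

/-- The generator of `Raag G` corresponding to a vertex. -/
def gen {V : Type} (G : SimpleGraph V) (v : V) : Raag G := PresentedGroup.of v

/-- `φ` is the partial conjugation conjugating the vertices of `C` by `x`. -/
def IsPartialConj {V : Type} (G : SimpleGraph V) (x : V) (C : Set V)
    (φ : MulAut (Raag G)) : Prop :=
  (∀ v ∈ C, φ (gen G v) = (gen G x)⁻¹ * gen G v * gen G x) ∧
  (∀ v ∉ C, φ (gen G v) = gen G v)

/-- `φ` is the transvection `R_u^v`, sending `u ↦ uv` and fixing all other vertices. -/
def IsTransvection {V : Type} (G : SimpleGraph V) (u v : V)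
    (φ : MulAut (Raag G)) : Prop :=
  φ (gen G u) = gen G u * gen G v ∧ ∀ w : V, w ≠ u → φ (gen G w) = gen G w

/-- The subgroup of inner automorphisms of a group. -/
def Inn (H : Type*) [Group H] : Subgroup (MulAut H) := (MulAut.conj : H →* MulAut H).range

instance Inn.normal (H : Type*) [Group H] : (Inn H).Normal := by
  constructor
  rintro a ⟨g, rfl⟩ f
  refine ⟨f g, ?_⟩
  ext x
  simp [MulAut.conj_apply, map_mul, map_inv]

/-- The outer automorphism group. -/
abbrev Out (H : Type*) [Group H] : Type _ := MulAut H ⧸ Inn H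

/-- Projection from automorphisms to outer automorphisms. -/
def toOut (H : Type*) [Group H] : MulAut H →* Out H := QuotientGroup.mk' (Inn H)

/-- The homomorphism sending an automorphism to the induced automorphism of the
abelianization. -/
def abAut (H : Type*) [Group H] : MulAut H →* MulAut (Abelianization H) where
  toFun e := MulEquiv.abelianizationCongr e
  map_one' := by
    apply MulEquiv.toMonoidHom_injective
    apply Abelianization.hom_ext
    ext x
    simp [abelianizationCongr_of]
  map_mul' f g := by
    apply MulEquiv.toMonoidHom_injective
    apply Abelianization.hom_ext
    ext x
    simp [abelianizationCongr_of, MulAut.mul_apply]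

lemma abAut_inn (H : Type*) [Group H] : ∀ a ∈ Inn H, abAut H a = 1 := by
  rintro a ⟨g, rfl⟩
  apply MulEquiv.toMonoidHom_injective
  apply Abelianization.hom_ext
  ext x
  simp [abAut, abelianizationCongr_of, MulAut.conj_apply, mul_comm]

/-- The standard map `ρ : Out(H) → Aut(Hᵃᵇ)` induced by acting on the abelianization. -/
def rhoOut (H : Type*) [Group H] : Out H →* MulAut (Abelianization H) :=
  QuotientGroup.lift (Inn H) (abAut H) (abAut_inn H)

end RaagPaper

namespace RaagPaper

/-- The generating set of `SOut⁰(A_Γ)`: images of all transvections and all partial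
conjugations. -/
def SOutGens {V : Type} (G : SimpleGraph V) : Set (Out (Raag G)) :=
  {o | ∃ φ : MulAut (Raag G), o = toOut (Raag G) φ ∧
    ((∃ u v : V, u ≠ v ∧ Dom G u v ∧ IsTransvection G u v φ) ∨
     (∃ (x : V) (C : Set V), IsUnionCC G x C ∧ IsPartialConj G x C φ))}

/-- `SOut⁰(A_Γ)`, the subgroup of `Out(A_Γ)` generated by the images of all
transvections and all partial conjugations. -/
def SOut0 {V : Type} (G : SimpleGraph V) : Subgroup (Out (Raag G)) :=
  Subgroup.closure (SOutGens G)

/-- The set `P^X_C` of images of the partial conjugations `π^w_{C∖st(w)}` over all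
vertices `w` dominating every element of `X`. -/
def PXC {V : Type} (G : SimpleGraph V) (X C : Set V) : Set (Out (Raag G)) :=
  {o | ∃ (w : V) (φ : MulAut (Raag G)), (∀ x ∈ X, Dom G x w) ∧
    IsPartialConj G w (C \ star G w) φ ∧ o = toOut (Raag G) φ}

end RaagPaper


namespace RaagPaper

/-! ### The free group of rank two -/

section F2

abbrev F2 : Type := FreeGroup Bool

abbrev fx : F2 := FreeGroup.of true
abbrev fy : F2 := FreeGroup.of false

/-- Automorphism of `F2` from the images of the generators under it and its inverse. -/
def mkAut (p q p' q' : F2)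
    (h1 : FreeGroup.lift (fun b => cond b p q) p' = fx)
    (h2 : FreeGroup.lift (fun b => cond b p q) q' = fy)
    (h3 : FreeGroup.lift (fun b => cond b p' q') p = fx)
    (h4 : FreeGroup.lift (fun b => cond b p' q') q = fy) : MulAut F2 :=
  MonoidHom.toMulEquiv (FreeGroup.lift (fun b => cond b p q))
    (FreeGroup.lift (fun b => cond b p' q'))
    (by ext b; cases b <;> simp [h3, h4])
    (by ext b; cases b <;> simp [h1, h2])

def fa : MulAut F2 := mkAut (fx * fy) fy (fx * fy⁻¹) fy
  (by simp) (by simp) (by simp) (by simp)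

def fb : MulAut F2 := mkAut fx (fy * fx) fx (fy * fx⁻¹)
  (by simp) (by simp) (by simp) (by simp)

def fs : MulAut F2 := mkAut fy fx⁻¹ fy⁻¹ fx
  (by simp) (by simp) (by simp) (by simp)

@[simp] lemma fa_x : fa fx = fx * fy := by simp [fa, mkAut]
@[simp] lemma fa_y : fa fy = fy := by simp [fa, mkAut]
@[simp] lemma fb_x : fb fx = fx := by simp [fb, mkAut]
@[simp] lemma fb_y : fb fy = fy * fx := by simp [fb, mkAut]
@[simp] lemma fs_x : fs fx = fy := by simp [fs, mkAut]
@[simp] lemma fs_y : fs fy = fx⁻¹ := by simp [fs, mkAut]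

lemma aut_ext {φ ψ : MulAut F2} (hx : φ fx = ψ fx) (hy : φ fy = ψ fy) : φ = ψ := by
  apply MulEquiv.toMonoidHom_injective
  ext b
  cases b
  · simpa using hy
  · simpa using hx

lemma toOut_eq_of {H : Type*} [Group H] (φ ψ : MulAut H) (h : H)
    (e : φ = MulAut.conj h * ψ) : toOut H φ = toOut H ψ := by
  subst e
  rw [map_mul]
  have : toOut H (MulAut.conj h) = 1 :=
    (QuotientGroup.eq_one_iff _).2 ⟨h, rfl⟩
  rw [this, one_mul]

lemma fs_four : fs ^ 4 = 1 := by
  apply aut_ext <;> simp [pow_succ, MulAut.mul_apply]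

lemma rel_comm : toOut F2 (fs ^ 2 * fa) = toOut F2 (fa * fs ^ 2) := by
  apply toOut_eq_of _ _ fy
  apply aut_ext <;> simp [pow_succ, MulAut.mul_apply, MulAut.conj_apply, mul_assoc]

lemma rel_asb : toOut F2 (fa * fs * fb) = toOut F2 fs := by
  apply toOut_eq_of _ _ fy⁻¹
  apply aut_ext <;> simp [MulAut.mul_apply, MulAut.conj_apply, mul_assoc]

lemma rel_asa : fa * fs * fa = fs ^ 2 * fb := by
  apply aut_ext <;> simp [pow_succ, MulAut.mul_apply]

/-- Normal form in a quotient of the standard presentation of `SL₂(ℤ)`. -/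
lemma normal_form {H : Type*} [Group H] (s a b : H) (h4 : s ^ 4 = 1)
    (hc : s ^ 2 * a = a * s ^ 2) (h1 : a * s * b = s) (h2 : a * s * a = s ^ 2 * b)
    (g : H) (hg : g ∈ Subgroup.closure ({a, b} : Set H)) :
    ∃ i j : ℕ, ∃ w ∈ Submonoid.closure ({a, b} : Set H), g = s ^ i * w * s ^ j := by
  set X : Set H := {g | ∃ i j : ℕ, ∃ w ∈ Submonoid.closure ({a, b} : Set H),
    g = s ^ i * w * s ^ j} with hX
  have X1 : (1 : H) ∈ X := ⟨0, 0, 1, one_mem _, by simp⟩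
  have Xs : ∀ g ∈ X, s * g ∈ X := by
    rintro g ⟨i, j, w, hw, rfl⟩
    exact ⟨i + 1, j, w, hw, by simp [pow_succ', mul_assoc]⟩
  have Xsn : ∀ (n : ℕ), ∀ g ∈ X, s ^ n * g ∈ X := by
    intro n
    induction n with
    | zero => intro g hg; simpa using hg
    | succ n ih =>
      intro g hg
      have := Xs _ (ih g hg)
      rwa [← mul_assoc, ← pow_succ'] at this
  have ha : a ∈ Submonoid.closure ({a, b} : Set H) := Submonoid.subset_closure (by simp)
  have hb : b ∈ Submonoid.closure ({a, b} : Set H) := Submonoid.subset_closure (by simp)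
  have hcomm : ∀ m : ℕ, a * s ^ (2 * m) = s ^ (2 * m) * a := by
    intro m
    have : Commute a (s ^ 2) := hc.symm
    rw [pow_mul]
    exact this.pow_right m
  have Xa : ∀ g ∈ X, a * g ∈ X := by
    rintro g ⟨i, j, w, hw, rfl⟩
    obtain ⟨m, rfl | rfl⟩ := Nat.even_or_odd' i
    · refine ⟨2 * m, j, a * w, mul_mem ha hw, ?_⟩
      simp only [← mul_assoc, hcomm]
    · have key : a * (s * w * s ^ j) ∈ X := by
        induction hw using Submonoid.closure_induction_left with
        | one => exact ⟨0, 1 + j, a, ha, by simp [pow_add, mul_assoc]⟩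
        | mul_left x hx w' hw' _ =>
          rcases hx with rfl | hx
          · refine ⟨2, j, b * w', mul_mem hb hw', ?_⟩
            calc _ = (x * s * x) * w' * s ^ j := by group
              _ = _ := by rw [h2]; simp only [mul_assoc]
          · obtain rfl : x = b := hx
            refine ⟨1, j, w', hw', ?_⟩
            calc _ = (a * s * x) * w' * s ^ j := by group
              _ = _ := by rw [h1]; simp
      have := Xsn (2 * m) _ key
      convert this using 1
      rw [← mul_assoc (s ^ (2 * m)) a, ← hcomm, pow_succ]
      simp only [mul_assoc]
  have Xb : ∀ g ∈ X, b * g ∈ X := by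
    intro g hg
    have e : b = s ^ 2 * a * s * a := by
      have : s ^ 2 * (a * s * a) = b := by
        rw [h2, ← mul_assoc, ← pow_add, h4, one_mul]
      rw [← this]; simp only [mul_assoc]
    have := Xsn 2 _ (Xa _ (Xs _ (Xa _ hg)))
    rw [e]; simpa only [mul_assoc] using this
  have s3 : s ^ 3 = s⁻¹ := by
    rw [eq_inv_iff_mul_eq_one, ← pow_succ, h4]
  have Xai : ∀ g ∈ X, a⁻¹ * g ∈ X := by
    intro g hg
    have e : a⁻¹ = s * b * s ^ 3 := by
      rw [s3, inv_eq_iff_mul_eq_one, ← mul_assoc, ← mul_assoc, h1, mul_inv_cancel]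
    have := Xs _ (Xb _ (Xsn 3 _ hg))
    rw [e]; simpa only [mul_assoc] using this
  have Xbi : ∀ g ∈ X, b⁻¹ * g ∈ X := by
    intro g hg
    have e : b⁻¹ = a⁻¹ * s ^ 3 * a⁻¹ * s ^ 2 := by
      rw [s3]
      have : b = (s ^ 2)⁻¹ * (a * s * a) := by rw [h2]; group
      rw [this]; group
    have := Xai _ (Xsn 3 _ (Xai _ (Xsn 2 _ hg)))
    rw [e]; simpa only [mul_assoc] using this
  change g ∈ X
  induction hg using Subgroup.closure_induction_left with
  | one => exact X1
  | mul_left x hx y hy ih =>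
    rcases hx with rfl | hx
    · exact Xa _ ih
    · obtain rfl : x = b := hx
      exact Xb _ ih
  | inv_mul_cancel x hx y hy ih =>
    rcases hx with rfl | hx
    · exact Xai _ ih
    · obtain rfl : x = b := hx
      exact Xbi _ ih

/-- Exponent sums. -/
def ex : F2 →* Multiplicative ℤ := FreeGroup.lift (fun b => Multiplicative.ofAdd (cond b 1 0))
def ey : F2 →* Multiplicative ℤ := FreeGroup.lift (fun b => Multiplicative.ofAdd (cond b 0 1))

def nx (g : F2) : ℤ := Multiplicative.toAdd (ex g)
def ny (g : F2) : ℤ := Multiplicative.toAdd (ey g)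

@[simp] lemma nx_mul (g h : F2) : nx (g * h) = nx g + nx h := by simp [nx]
@[simp] lemma ny_mul (g h : F2) : ny (g * h) = ny g + ny h := by simp [ny]
@[simp] lemma nx_inv (g : F2) : nx g⁻¹ = - nx g := by simp [nx]
@[simp] lemma ny_inv (g : F2) : ny g⁻¹ = - ny g := by simp [ny]
@[simp] lemma nx_one : nx 1 = 0 := by simp [nx]
@[simp] lemma ny_one : ny 1 = 0 := by simp [ny]
@[simp] lemma nx_x : nx fx = 1 := by simp [nx, ex]
@[simp] lemma nx_y : nx fy = 0 := by simp [nx, ex]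
@[simp] lemma ny_x : ny fx = 0 := by simp [ny, ey]
@[simp] lemma ny_y : ny fy = 1 := by simp [ny, ey]

lemma f2_ind {P : F2 → Prop} (h1 : P 1) (hx : P fx) (hy : P fy)
    (hi : ∀ g, P g → P g⁻¹) (hm : ∀ g h, P g → P h → P (g * h)) (g : F2) : P g := by
  induction g using FreeGroup.induction_on with
  | C1 => exact h1
  | of b => cases b
            · exact hy
            · exact hx
  | inv_of b h => exact hi _ h
  | mul g h hg hh => exact hm _ _ hg hh

lemma nx_fa (g : F2) : nx (fa g) = nx g := by
  induction g using f2_ind <;> simp_all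
lemma ny_fa (g : F2) : ny (fa g) = nx g + ny g := by
  induction g using f2_ind with
  | hm g h h1 h2 => simp only [map_mul, ny_mul, nx_mul, h1, h2]; ring
  | hi g h => simp only [map_inv, ny_inv, nx_inv, h]; ring
  | _ => simp
lemma nx_fb (g : F2) : nx (fb g) = nx g + ny g := by
  induction g using f2_ind with
  | hm g h h1 h2 => simp only [map_mul, ny_mul, nx_mul, h1, h2]; ring
  | hi g h => simp only [map_inv, ny_inv, nx_inv, h]; ring
  | _ => simp
lemma ny_fb (g : F2) : ny (fb g) = ny g := by
  induction g using f2_ind <;> simp_all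

lemma positive_word (w : Out F2)
    (hw : w ∈ Submonoid.closure ({toOut F2 fa, toOut F2 fb} : Set (Out F2))) :
    ∃ α : MulAut F2, toOut F2 α = w ∧ 1 ≤ nx (α fx) ∧ 0 ≤ ny (α fx) ∧ 0 ≤ nx (α fy) ∧
      1 ≤ ny (α fy) ∧ (α = 1 ∨ 1 ≤ ny (α fx) + nx (α fy)) := by
  induction hw using Submonoid.closure_induction_left with
  | one => exact ⟨1, by simp, by simp, by simp, by simp, by simp, Or.inl rfl⟩
  | mul_left x hx w' hw' ih =>
    obtain ⟨α, rfl, h1, h2, h3, h4, -⟩ := ih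
    rcases hx with rfl | hx
    · refine ⟨fa * α, by simp, ?_⟩
      simp only [MulAut.mul_apply, nx_fa, ny_fa]
      refine ⟨by omega, by omega, by omega, by omega, Or.inr (by omega)⟩
    · obtain rfl : x = toOut F2 fb := hx
      refine ⟨fb * α, by simp, ?_⟩
      simp only [MulAut.mul_apply, nx_fb, ny_fb]
      refine ⟨by omega, by omega, by omega, by omega, Or.inr (by omega)⟩

lemma ab_of_eq {H : Type*} [Group H] {φ : MulAut H} (h : abAut H φ = 1) (g : H) :
    Abelianization.of (φ g) = Abelianization.of g := by
  have := congrArg (fun e : MulAut (Abelianization H) => e (Abelianization.of g)) h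
  simpa [abAut, abelianizationCongr_of] using this

lemma hom_of_eq {H C : Type*} [Group H] [CommGroup C] {φ : MulAut H} (h : abAut H φ = 1)
    (f : H →* C) (g : H) : f (φ g) = f g := by
  have := congrArg (Abelianization.lift f) (ab_of_eq h g)
  simpa using this

lemma abAut_eq_one {H : Type*} [Group H] {φ : MulAut H}
    (h : ∀ g, Abelianization.of (φ g) = Abelianization.of g) : abAut H φ = 1 := by
  apply MulEquiv.toMonoidHom_injective
  apply Abelianization.hom_ext
  ext x
  simpa [abAut, abelianizationCongr_of] using h x

lemma rhoOut_toOut {H : Type*} [Group H] (φ : MulAut H) :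
    rhoOut H (toOut H φ) = abAut H φ := rfl

/-- The part of Nielsen's theorem that we need. -/
lemma f2_inner (α : MulAut F2) (hα : α ∈ Subgroup.closure ({fa, fb} : Set (MulAut F2)))
    (hab : abAut F2 α = 1) : α ∈ Inn F2 := by
  have hα' : toOut F2 α ∈ Subgroup.closure ({toOut F2 fa, toOut F2 fb} : Set (Out F2)) := by
    have := Subgroup.mem_map_of_mem (toOut F2) hα
    rwa [MonoidHom.map_closure, Set.image_pair] at this
  obtain ⟨i, j, w, hw, e⟩ := normal_form (toOut F2 fs) (toOut F2 fa) (toOut F2 fb)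
    (by rw [← map_pow, fs_four, map_one])
    (by simpa using rel_comm) (by simpa using rel_asb)
    (by simpa using congrArg (toOut F2) rel_asa) _ hα'
  obtain ⟨ω, rfl, h1, h2, h3, h4, h5⟩ := positive_word w hw
  have e2 : abAut F2 (fs ^ i * ω * fs ^ j) = 1 := by
    rw [← rhoOut_toOut]
    have : toOut F2 (fs ^ i * ω * fs ^ j) = toOut F2 α := by
      rw [e]; simp only [map_mul, map_pow]
    rw [this, rhoOut_toOut, hab]
  have e3 : abAut F2 (ω * fs ^ (j + i)) = 1 := by
    have : ω * fs ^ (j + i) = (fs ^ i)⁻¹ * (fs ^ i * ω * fs ^ j) * fs ^ i := by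
      rw [pow_add]; group
    rw [this, map_mul, map_mul, e2, mul_one, ← map_mul, inv_mul_cancel, map_one]
  have red : fs ^ (j + i) = fs ^ ((j + i) % 4) := by
    conv_lhs => rw [← Nat.div_add_mod (j + i) 4, pow_add, pow_mul, fs_four, one_pow, one_mul]
  have hlt : (j + i) % 4 < 4 := Nat.mod_lt _ (by norm_num)
  have hx1 : ∀ g, nx ((ω * fs ^ (j + i)) g) = nx g := fun g => hom_of_eq e3 ex g
  have hy1 : ∀ g, ny ((ω * fs ^ (j + i)) g) = ny g := fun g => hom_of_eq e3 ey g
  rw [red] at hx1 hy1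
  generalize hk : (j + i) % 4 = k at *
  interval_cases k
  · have a1 := hy1 fx
    have a2 := hx1 fy
    simp at a1 a2
    rcases h5 with h5 | h5
    · subst h5
      have : toOut F2 α = 1 := by
        rw [e, map_one, mul_one, ← map_pow, ← map_pow, ← map_mul, ← pow_add, add_comm i j, red]
        simp
      exact (QuotientGroup.eq_one_iff _).1 this
    · omega
  · have := hy1 fx
    simp [MulAut.mul_apply] at this
    omega
  · have := hx1 fx
    simp [MulAut.mul_apply, pow_succ] at this
    omega
  · have := hy1 fx
    simp [MulAut.mul_apply, pow_succ] at this
    omega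

end F2

/-! ### Graph lemmas -/

section Graph

variable {V : Type} {G : SimpleGraph V}

lemma dom_iff {u v : V} : Dom G u v ↔ ∀ x, G.Adj u x → x = v ∨ G.Adj v x := by
  simp [Dom, star, Set.subset_def]

lemma Dom.trans' {u v w : V} (h1 : Dom G u v) (h2 : Dom G v w) : Dom G u w := by
  rw [dom_iff] at *
  intro x hx
  rcases h1 x hx with rfl | h
  · rcases h2 u hx.symm with rfl | h'
    · exact Or.inr hx
    · rcases h1 w h'.symm with rfl | h''
      · exact Or.inl rfl
      · exact Or.inr h''.symm
  · exact h2 x h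

lemma reach_isolated {S : Set V} {u : V} (hu : u ∈ S) (hiso : ∀ x ∈ S, ¬ G.Adj u x)
    {y : S} (h : (G.induce S).Reachable ⟨u, hu⟩ y) : (y : V) = u := by
  obtain ⟨p⟩ := h
  cases p with
  | nil => rfl
  | cons hadj _ => exact absurd hadj (hiso _ (Subtype.property _))

lemma cc_isolated {S C : Set V} {u x : V} (hC : IsCC G S C) (hu : u ∈ C)
    (hiso : ∀ x ∈ S, ¬ G.Adj u x) (hx : x ∈ C) : x = u := by
  obtain ⟨v, rfl⟩ := hC
  obtain ⟨hu, r1⟩ := hu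
  obtain ⟨hx, r2⟩ := hx
  exact reach_isolated hu hiso (r1.trans r2.symm)

lemma adj_of_dom (hn : HasNoSIL G) {u v w : V} (huv : u ≠ v) (huw : u ≠ w) (hvw : v ≠ w)
    (h1 : Dom G u v) (h2 : Dom G u w) : G.Adj v w := by
  by_contra hadj
  rw [dom_iff] at h1 h2
  have n1 : ¬ G.Adj u v := fun h => by
    rcases h2 v h with h | h
    · exact hvw h
    · exact hadj h.symm
  have n2 : ¬ G.Adj u w := fun h => by
    rcases h1 w h with h | h
    · exact hvw h.symm
    · exact hadj h
  refine hn v w u ⟨hvw, huv.symm, huw.symm, hadj, fun h => n1 h.symm, fun h => n2 h.symm, ?_⟩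
  intro C hC hu
  have hiso : ∀ x ∈ (G.neighborSet v ∩ G.neighborSet w)ᶜ, ¬ G.Adj u x := by
    intro x hx ha
    apply hx
    constructor
    · rcases h1 x ha with rfl | h
      · exact absurd ha n1
      · exact h
    · rcases h2 x ha with rfl | h
      · exact absurd ha n2
      · exact h
  exact ⟨fun h => huv (cc_isolated hC hu hiso h).symm, fun h => huw (cc_isolated hC hu hiso h).symm⟩

/-- `u` and `v` span a free group of rank two and are domination-equivalent. -/
def Bad (G : SimpleGraph V) (u v : V) : Prop := u ≠ v ∧ ¬ G.Adj u v ∧ Dom G u v ∧ Dom G v u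

lemma Bad.symm {u v : V} (h : Bad G u v) : Bad G v u :=
  ⟨h.1.symm, fun k => h.2.1 k.symm, h.2.2.2, h.2.2.1⟩

lemma Bad.adj (hn : HasNoSIL G) {u v z : V} (h : Bad G u v) (hu : z ≠ u) (hv : z ≠ v) :
    G.Adj u z := by
  obtain ⟨huv, hna, h1, h2⟩ := h
  rw [dom_iff] at h1 h2
  by_contra hz
  have hz' : ¬ G.Adj v z := fun k => by
    rcases h2 z k with k | k
    · exact hu k
    · exact hz k
  have l1 : ∀ x, G.Adj u x → G.Adj v x := fun x hx => by
    rcases h1 x hx with rfl | k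
    · exact absurd hx hna
    · exact k
  have l2 : ∀ x, G.Adj v x → G.Adj u x := fun x hx => by
    rcases h2 x hx with rfl | k
    · exact absurd hx.symm hna
    · exact k
  refine hn u v z ⟨huv, hu.symm, hv.symm, hna, hz, hz', ?_⟩
  intro C hC hzC
  constructor
  · intro h
    exact hu (cc_isolated hC h (fun x hx ha => hx ⟨ha, l1 x ha⟩) hzC)
  · intro h
    exact hv (cc_isolated hC h (fun x hx ha => hx ⟨l2 x ha, ha⟩) hzC)

lemma Bad.not_dom (hn : HasNoSIL G) {u v z : V} (h : Bad G u v) (hu : z ≠ u) (hv : z ≠ v) :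
    ¬ Dom G z u := by
  intro hd
  rcases (dom_iff.1 hd) v (h.symm.adj hn hv hu).symm with k | k
  · exact h.1 k.symm
  · exact h.2.1 k

lemma Bad.central (hn : HasNoSIL G) {u v z : V} (h : Bad G u v) (hu : z ≠ u) (hv : z ≠ v)
    (hd : Dom G u z) (w : V) (hw : w ≠ z) : G.Adj z w := by
  by_cases e1 : w = u
  · subst e1; exact (h.adj hn hu hv).symm
  by_cases e2 : w = v
  · subst e2; exact (h.symm.adj hn hv hu).symm
  rcases (dom_iff.1 hd) w (h.adj hn e1 e2) with k | k
  · exact absurd k hw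
  · exact k

/-- The vertices above some `w ≠ u` with `u ≤ w`. -/
def Up (G : SimpleGraph V) (u : V) : Set V := {v | ∃ w, w ≠ u ∧ Dom G u w ∧ Dom G w v}

lemma up_clique (hn : HasNoSIL G) {u : V} (ht : ∀ v, ¬ Bad G u v) {p q : V}
    (hp : p ∈ Up G u) (hq : q ∈ Up G u) (hpq : p ≠ q) : G.Adj p q := by
  have key : ∀ q, u ∈ Up G u → q ∈ Up G u → u ≠ q → G.Adj u q := by
    rintro q ⟨w, hw, h1, h2⟩ ⟨w', -, h3, h4⟩ hne
    have huw : G.Adj u w := by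
      by_contra hna
      exact ht w ⟨hw.symm, hna, h1, h2⟩
    have hq := h3.trans' h4
    rcases (dom_iff.1 hq) w huw with rfl | k
    · exact huw
    · rcases (dom_iff.1 h2) q k.symm with k' | k'
      · exact absurd k'.symm hne
      · exact k'
  by_cases e1 : p = u
  · subst e1; exact key q hp hq hpq
  by_cases e2 : q = u
  · subst e2; exact (key p hq hp (Ne.symm hpq)).symm
  obtain ⟨w, -, h1, h2⟩ := hp
  obtain ⟨w', -, h3, h4⟩ := hq
  exact adj_of_dom hn (Ne.symm e1) (Ne.symm e2) hpq (h1.trans' h2) (h3.trans' h4)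

end Graph

/-! ### The right-angled Artin group -/

section RAAG

variable {V : Type} {G : SimpleGraph V}

lemma gen_comm {u v : V} (h : G.Adj u v) : Commute (gen G u) (gen G v) := by
  have : (PresentedGroup.mk (Rels G)
      (FreeGroup.of u * FreeGroup.of v * (FreeGroup.of u)⁻¹ * (FreeGroup.of v)⁻¹)) = 1 :=
    PresentedGroup.one_of_mem ⟨u, v, h, rfl⟩
  simp only [map_mul, map_inv] at this
  rw [mul_inv_eq_one, mul_inv_eq_iff_eq_mul] at this
  exact this

/-- Homomorphisms out of the RAAG. -/
def raagLift {H : Type*} [Group H] (f : V → H) (hf : ∀ u v, G.Adj u v → Commute (f u) (f v)) :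
    Raag G →* H :=
  PresentedGroup.toGroup (f := f) (by
    rintro r ⟨u, v, h, rfl⟩
    simp only [map_mul, map_inv, FreeGroup.lift_apply_of]
    rw [mul_inv_eq_one, mul_inv_eq_iff_eq_mul]
    exact hf u v h)

@[simp] lemma raagLift_gen {H : Type*} [Group H] (f : V → H)
    (hf : ∀ u v, G.Adj u v → Commute (f u) (f v)) (v : V) :
    raagLift f hf (gen G v) = f v := by
  simp [raagLift, gen]

lemma raag_hom_ext {H : Type*} [Group H] {f g : Raag G →* H}
    (h : ∀ v, f (gen G v) = g (gen G v)) : f = g :=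
  PresentedGroup.ext h

lemma raag_aut_ext {f g : MulAut (Raag G)}
    (h : ∀ v, f (gen G v) = g (gen G v)) : f = g := by
  apply MulEquiv.toMonoidHom_injective
  exact raag_hom_ext h

/-- On subgroups generated by cliques the abelianization map is injective. -/
lemma clique_inj {E : Set V} (hE : ∀ p ∈ E, ∀ q ∈ E, p ≠ q → G.Adj p q) {k : Raag G}
    (hk : k ∈ Subgroup.closure (gen G '' E))
    (hab : (Abelianization.of k : Abelianization (Raag G)) = 1) : k = 1 := by
  classical
  have hcomm : ∀ x ∈ gen G '' E, ∀ y ∈ gen G '' E, x * y = y * x := by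
    rintro _ ⟨p, hp, rfl⟩ _ ⟨q, hq, rfl⟩
    by_cases h : p = q
    · rw [h]
    · exact gen_comm (hE p hp q hq h)
  have hK := Subgroup.isMulCommutative_closure hcomm
  have hK' : ∀ x y : Subgroup.closure (gen G '' E), x * y = y * x := hK.is_comm.comm
  letI : CommGroup (Subgroup.closure (gen G '' E)) :=
    { (Subgroup.closure (gen G '' E)).toGroup with mul_comm := hK' }
  let m : Raag G →* Subgroup.closure (gen G '' E) :=
    raagLift (fun v => if h : v ∈ E then
      ⟨gen G v, Subgroup.subset_closure ⟨v, h, rfl⟩⟩ else 1)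
      (fun u v _ => hK' _ _)
  have hm : ∀ k ∈ Subgroup.closure (gen G '' E), ((m k : Subgroup.closure (gen G '' E)) : Raag G) = k := by
    intro k hk
    induction hk using Subgroup.closure_induction with
    | mem x hx =>
      obtain ⟨v, hv, rfl⟩ := hx
      have : m (gen G v) = ⟨gen G v, Subgroup.subset_closure ⟨v, hv, rfl⟩⟩ := by
        exact (raagLift_gen _ _ v).trans (dif_pos hv)
      rw [this]
    | one => rw [map_one]; rfl
    | mul x y _ _ hx hy => rw [map_mul, Subgroup.coe_mul, hx, hy]
    | inv x _ hx => rw [map_inv, Subgroup.coe_inv, hx]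
  have h1 : m k = 1 := by
    have := congrArg (Abelianization.lift m) hab
    simpa using this
  rw [← hm k hk, h1]
  rfl

/-- The group generated by transvections. -/
def TV (G : SimpleGraph V) : Subgroup (MulAut (Raag G)) :=
  Subgroup.closure {φ | ∃ u v : V, u ≠ v ∧ Dom G u v ∧ IsTransvection G u v φ}

def KU (G : SimpleGraph V) (u : V) : Subgroup (Raag G) := Subgroup.closure (gen G '' Up G u)

lemma tv_inv {u v : V} {φ : MulAut (Raag G)} (huv : u ≠ v) (h : IsTransvection G u v φ) :
    φ⁻¹ (gen G u) = gen G u * (gen G v)⁻¹ ∧ ∀ w, w ≠ u → φ⁻¹ (gen G w) = gen G w := by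
  have h2 : ∀ w, w ≠ u → φ⁻¹ (gen G w) = gen G w := by
    intro w hw
    conv_lhs => rw [← h.2 w hw]
    exact φ.symm_apply_apply _
  refine ⟨?_, h2⟩
  have : φ⁻¹ (gen G u * gen G v) = gen G u := by
    rw [← h.1]
    exact φ.symm_apply_apply _
  rw [map_mul, h2 v huv.symm] at this
  rw [eq_mul_inv_iff_mul_eq, this]

/-- Elements of `TV` preserve `KU u` and the coset `u * KU u`. -/
lemma tv_KU {φ : MulAut (Raag G)} (hφ : φ ∈ TV G) (u : V) :
    (∀ k ∈ KU G u, φ k ∈ KU G u) ∧ ∃ k ∈ KU G u, φ (gen G u) = gen G u * k := by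
  have step : ∀ ψ : MulAut (Raag G), (∃ p q : V, p ≠ q ∧ Dom G p q ∧
      (∃ e ∈ Subgroup.closure {gen G q}, ψ (gen G p) = gen G p * e) ∧
        ∀ w, w ≠ p → ψ (gen G w) = gen G w) →
      (∀ k ∈ KU G u, ψ k ∈ KU G u) ∧ ∃ k ∈ KU G u, ψ (gen G u) = gen G u * k := by
    rintro ψ ⟨p, q, hpq, hd, ⟨e, he, h1⟩, h2⟩
    constructor
    · intro k hk
      have : KU G u ≤ (KU G u).comap ψ.toMonoidHom := by
        unfold KU
        rw [Subgroup.closure_le]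
        rintro _ ⟨v, hv, rfl⟩
        change ψ (gen G v) ∈ KU G u
        by_cases hvp : v = p
        · subst hvp
          rw [h1]
          refine mul_mem (Subgroup.subset_closure ⟨v, hv, rfl⟩) ?_
          refine (Subgroup.closure_le _).2 ?_ he
          rintro _ rfl
          obtain ⟨w, a, b, c⟩ := hv
          exact Subgroup.subset_closure ⟨q, ⟨w, a, b, c.trans' hd⟩, rfl⟩
        · rw [h2 v hvp]
          exact Subgroup.subset_closure ⟨v, hv, rfl⟩
      exact this hk
    · by_cases hup : u = p
      · subst hup
        refine ⟨e, ?_, h1⟩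
        refine (Subgroup.closure_le _).2 ?_ he
        rintro _ rfl
        exact Subgroup.subset_closure ⟨q, ⟨q, hpq.symm, hd, by rw [dom_iff]; tauto⟩, rfl⟩
      · exact ⟨1, one_mem _, by rw [h2 u hup, mul_one]⟩
  unfold TV at hφ
  induction hφ using Subgroup.closure_induction_left with
  | one => exact ⟨fun k hk => hk, 1, one_mem _, by simp⟩
  | mul_left x hx y hy ih =>
    obtain ⟨p, q, hpq, hd, ht⟩ := hx
    obtain ⟨s1, k1, hk1, e1⟩ := step x ⟨p, q, hpq, hd,
      ⟨gen G q, Subgroup.subset_closure rfl, ht.1⟩, ht.2⟩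
    obtain ⟨s2, k2, hk2, e2⟩ := ih
    refine ⟨fun k hk => s1 _ (s2 _ hk), k1 * x k2, mul_mem hk1 (s1 _ hk2), ?_⟩
    rw [MulAut.mul_apply, e2, map_mul, e1, mul_assoc]
  | inv_mul_cancel x hx y hy ih =>
    obtain ⟨p, q, hpq, hd, ht⟩ := hx
    have ht' := tv_inv hpq ht
    obtain ⟨s1, k1, hk1, e1⟩ := step x⁻¹ ⟨p, q, hpq, hd,
      ⟨(gen G q)⁻¹, inv_mem (Subgroup.subset_closure rfl), ht'.1⟩, ht'.2⟩
    obtain ⟨s2, k2, hk2, e2⟩ := ih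
    refine ⟨fun k hk => s1 _ (s2 _ hk), k1 * x⁻¹ k2, mul_mem hk1 (s1 _ hk2), ?_⟩
    rw [MulAut.mul_apply, e2, map_mul, e1, mul_assoc]

/-- Tame vertices are fixed by elements of `TV` acting trivially on the abelianization. -/
lemma tame_fixed (hn : HasNoSIL G) {φ : MulAut (Raag G)} (hφ : φ ∈ TV G)
    (hab : abAut (Raag G) φ = 1) {u : V} (ht : ∀ v, ¬ Bad G u v) :
    φ (gen G u) = gen G u := by
  obtain ⟨-, k, hk, e⟩ := tv_KU hφ u
  have : k = 1 := by
    refine clique_inj (fun p hp q hq => up_clique hn ht hp hq) hk ?_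
    have := ab_of_eq hab (gen G u)
    rw [e, map_mul] at this
    exact mul_eq_left.1 this
  rw [e, this, mul_one]

open Classical in
/-- Projection onto the free group on a bad pair. -/
noncomputable def proj (G : SimpleGraph V) {u v : V} (h : Bad G u v) : Raag G →* F2 :=
  raagLift (fun w => if w = u then fx else if w = v then fy else 1) (by
    intro p q hpq
    by_cases p1 : p = u
    · by_cases q1 : q = u
      · subst p1; subst q1; exact Commute.refl _
      · by_cases q2 : q = v
        · subst p1; subst q2; exact absurd hpq h.2.1
        · simp [q1, q2]
    · by_cases p2 : p = v
      · by_cases q1 : q = u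
        · subst p2; subst q1; exact absurd hpq.symm h.2.1
        · by_cases q2 : q = v
          · subst p2; subst q2; exact Commute.refl _
          · simp [q1, q2]
      · simp [p1, p2])

lemma proj_u {u v : V} (h : Bad G u v) : proj G h (gen G u) = fx := by simp [proj]
lemma proj_v {u v : V} (h : Bad G u v) : proj G h (gen G v) = fy := by
  simp [proj, h.1.symm]
lemma proj_o {u v w : V} (h : Bad G u v) (h1 : w ≠ u) (h2 : w ≠ v) :
    proj G h (gen G w) = 1 := by simp [proj, h1, h2]

def incl (G : SimpleGraph V) (u v : V) : F2 →* Raag G :=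
  FreeGroup.lift (fun b => cond b (gen G u) (gen G v))

@[simp] lemma incl_x (u v : V) : incl G u v fx = gen G u := by simp [incl]
@[simp] lemma incl_y (u v : V) : incl G u v fy = gen G v := by simp [incl]

lemma proj_incl {u v : V} (h : Bad G u v) (f : F2) : proj G h (incl G u v f) = f := by
  induction f using f2_ind with
  | h1 => simp
  | hx => rw [incl_x, proj_u]
  | hy => rw [incl_y, proj_v]
  | hi g ih => rw [map_inv, map_inv, ih]
  | hm g k ih1 ih2 => rw [map_mul, map_mul, ih1, ih2]

lemma tv_proj (hn : HasNoSIL G) {u v : V} (h : Bad G u v) {φ : MulAut (Raag G)}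
    (hφ : φ ∈ TV G) : ∃ α ∈ Subgroup.closure ({fa, fb} : Set (MulAut F2)),
      ∀ g, proj G h (φ g) = α (proj G h g) := by
  unfold TV at hφ
  induction hφ using Subgroup.closure_induction with
  | mem φ hx =>
    obtain ⟨p, q, hpq, hd, ht⟩ := hx
    have red : ∀ α : MulAut F2, (∀ w, proj G h (φ (gen G w)) = α (proj G h (gen G w))) →
        ∀ g, proj G h (φ g) = α (proj G h g) := by
      intro α hα g
      have : (proj G h).comp φ.toMonoidHom = α.toMonoidHom.comp (proj G h) := raag_hom_ext hα
      exact DFunLike.congr_fun this g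
    by_cases q1 : q = u
    · subst q1
      have p1 : p = v := by
        by_contra hp
        exact h.not_dom hn hpq hp hd
      subst p1
      refine ⟨fb, Subgroup.subset_closure (by simp), red _ ?_⟩
      intro w
      by_cases hw : w = p
      · subst hw; rw [ht.1, map_mul, proj_u, proj_v, fb_y]
      · rw [ht.2 w hw]
        by_cases hw' : w = q
        · subst hw'; rw [proj_u, fb_x]
        · rw [proj_o h hw' hw, map_one]
    by_cases q2 : q = v
    · subst q2
      have p1 : p = u := by
        by_contra hp
        exact h.symm.not_dom hn hpq hp hd
      subst p1
      refine ⟨fa, Subgroup.subset_closure (by simp), red _ ?_⟩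
      intro w
      by_cases hw : w = p
      · subst hw; rw [ht.1, map_mul, proj_u, proj_v, fa_x]
      · rw [ht.2 w hw]
        by_cases hw' : w = q
        · subst hw'; rw [proj_v, fa_y]
        · rw [proj_o h hw hw', map_one]
    refine ⟨1, one_mem _, red _ ?_⟩
    intro w
    by_cases hw : w = p
    · subst hw; rw [ht.1, map_mul, proj_o h q1 q2, mul_one]; rfl
    · rw [ht.2 w hw]; rfl
  | one => exact ⟨1, one_mem _, fun g => rfl⟩
  | mul x y _ _ hx hy =>
    obtain ⟨α, hα, h1⟩ := hx
    obtain ⟨β, hβ, h2⟩ := hy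
    exact ⟨α * β, mul_mem hα hβ, fun g => by rw [MulAut.mul_apply, h1, h2, MulAut.mul_apply]⟩
  | inv x _ hx =>
    obtain ⟨α, hα, h1⟩ := hx
    refine ⟨α⁻¹, inv_mem hα, fun g => ?_⟩
    have := h1 (x⁻¹ g)
    rw [MulAut.apply_inv_self] at this
    rw [this, MulAut.inv_apply_self]

/-- Elements of `KU u`, for bad `u`, split as a product. -/
lemma KU_split (hn : HasNoSIL G) {u v : V} (h : Bad G u v) {k : Raag G} (hk : k ∈ KU G u) :
    ∃ f : F2, ∃ c ∈ Subgroup.closure (gen G '' {z | z ≠ u ∧ z ≠ v ∧ ∀ w, w ≠ z → G.Adj z w}),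
      k = incl G u v f * c := by
  set Z := {z | z ≠ u ∧ z ≠ v ∧ ∀ w, w ≠ z → G.Adj z w} with hZ
  have hcen : ∀ c ∈ Subgroup.closure (gen G '' Z), ∀ f : F2, Commute c (incl G u v f) := by
    intro c hc f
    have hc' : c ∈ Subgroup.centralizer ({gen G u, gen G v} : Set (Raag G)) := by
      refine (Subgroup.closure_le _).2 ?_ hc
      rintro _ ⟨z, hz, rfl⟩
      rw [SetLike.mem_coe, Subgroup.mem_centralizer_iff]
      rintro y (rfl | rfl)
      · exact (gen_comm (hz.2.2 u hz.1.symm)).symm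
      · exact (gen_comm (hz.2.2 v hz.2.1.symm)).symm
    rw [Subgroup.mem_centralizer_iff] at hc'
    induction f using f2_ind with
    | h1 => simp
    | hx => rw [incl_x]; exact (hc' _ (by simp)).symm
    | hy => rw [incl_y]; exact (hc' _ (by simp)).symm
    | hi g ih => rw [map_inv]; exact ih.inv_right
    | hm g k ih1 ih2 => rw [map_mul]; exact ih1.mul_right ih2
  unfold KU at hk
  induction hk using Subgroup.closure_induction with
  | mem x hx =>
    obtain ⟨z, ⟨w, -, a, b⟩, rfl⟩ := hx
    have hd := a.trans' b
    by_cases z1 : z = u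
    · subst z1; exact ⟨fx, 1, one_mem _, by simp⟩
    by_cases z2 : z = v
    · subst z2; exact ⟨fy, 1, one_mem _, by simp⟩
    exact ⟨1, gen G z, Subgroup.subset_closure ⟨z, ⟨z1, z2, h.central hn z1 z2 hd⟩, rfl⟩, by simp⟩
  | one => exact ⟨1, 1, one_mem _, by simp⟩
  | mul x y _ _ hx hy =>
    obtain ⟨f1, c1, hc1, rfl⟩ := hx
    obtain ⟨f2, c2, hc2, rfl⟩ := hy
    refine ⟨f1 * f2, c1 * c2, mul_mem hc1 hc2, ?_⟩
    rw [map_mul]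
    have := (hcen c1 hc1 f2).eq
    calc _ = incl G u v f1 * (c1 * incl G u v f2) * c2 := by group
      _ = _ := by rw [this]; group
  | inv x _ hx =>
    obtain ⟨f1, c1, hc1, rfl⟩ := hx
    refine ⟨f1⁻¹, c1⁻¹, inv_mem hc1, ?_⟩
    rw [mul_inv_rev, map_inv]
    exact (hcen c1 hc1 f1).inv_inv.eq

lemma bad_image (hn : HasNoSIL G) {u v : V} (h : Bad G u v) {φ : MulAut (Raag G)}
    (hφ : φ ∈ TV G) (hab : abAut (Raag G) φ = 1) :
    φ (gen G u) = incl G u v (proj G h (φ (gen G u))) := by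
  obtain ⟨-, k, hk, e⟩ := tv_KU hφ u
  obtain ⟨f, c, hc, rfl⟩ := KU_split hn h hk
  have hpc : proj G h c = 1 := by
    have : c ∈ (proj G h).ker := by
      refine (Subgroup.closure_le _).2 ?_ hc
      rintro _ ⟨z, hz, rfl⟩
      exact proj_o h hz.1 hz.2.1
    exact this
  have e' : φ (gen G u) = incl G u v (fx * f) * c := by
    rw [e, map_mul, incl_x, mul_assoc]
  have hp : proj G h (φ (gen G u)) = fx * f := by
    rw [e', map_mul, proj_incl, hpc, mul_one]
  have hc1 : c = 1 := by
    refine clique_inj (fun p hp q hq hpq => hp.2.2 q hpq.symm) hc ?_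
    have h1 := ab_of_eq hab (gen G u)
    have h3 : (Abelianization.of (incl G u v (fx * f)) : Abelianization (Raag G))
        = Abelianization.of (gen G u) := by
      have h4 : (Abelianization.of (fx * f) : Abelianization F2) = Abelianization.of fx := by
        rw [← hp, ← proj_u h]
        exact hom_of_eq hab ((Abelianization.of).comp (proj G h)) (gen G u)
      have := congrArg (Abelianization.lift
        ((Abelianization.of : Raag G →* _).comp (incl G u v))) h4
      simpa using this
    rw [e', map_mul, h3] at h1
    exact mul_eq_left.1 h1
  rw [hp, e', hc1, mul_one]

lemma bad_conj (hn : HasNoSIL G) {u v : V} (h : Bad G u v) {φ : MulAut (Raag G)}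
    (hφ : φ ∈ TV G) (hab : abAut (Raag G) φ = 1) :
    ∃ f : F2, φ (gen G u) = MulAut.conj (incl G u v f) (gen G u) ∧
      φ (gen G v) = MulAut.conj (incl G u v f) (gen G v) := by
  obtain ⟨α, hα, hα'⟩ := tv_proj hn h hφ
  have : α ∈ Inn F2 := by
    apply f2_inner α hα
    apply abAut_eq_one
    intro f
    rw [← proj_incl h f, ← hα']
    exact hom_of_eq hab ((Abelianization.of).comp (proj G h)) _
  obtain ⟨f, rfl⟩ := this
  refine ⟨f, ?_, ?_⟩
  · rw [bad_image hn h hφ hab, hα', proj_u]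
    simp [MulAut.conj_apply]
  · have hsw : ∀ g, incl G v u (proj G h.symm g) = incl G u v (proj G h g) := by
      intro g
      have : (incl G v u).comp (proj G h.symm) = (incl G u v).comp (proj G h) := by
        apply raag_hom_ext
        intro w
        simp only [MonoidHom.comp_apply]
        by_cases h1 : w = u
        · subst h1; rw [proj_u, proj_v, incl_x, incl_y]
        by_cases h2 : w = v
        · subst h2; rw [proj_u, proj_v, incl_x, incl_y]
        rw [proj_o _ h2 h1, proj_o _ h1 h2, map_one, map_one]
      exact DFunLike.congr_fun this g
    rw [bad_image hn h.symm hφ hab, hsw, hα', proj_v]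
    simp [MulAut.conj_apply]

lemma incl_commute {u v w : V} (hu : G.Adj u w) (hv : G.Adj v w) (f : F2) :
    Commute (incl G u v f) (gen G w) := by
  induction f using f2_ind with
  | h1 => simp
  | hx => rw [incl_x]; exact gen_comm hu
  | hy => rw [incl_y]; exact gen_comm hv
  | hi g ih => rw [map_inv]; exact ih.inv_left
  | hm g k ih1 ih2 => rw [map_mul]; exact ih1.mul_left ih2

lemma conj_fix {H : Type*} [Group H] {g x : H} (h : Commute g x) : MulAut.conj g x = x := by
  rw [MulAut.conj_apply, h.eq, mul_inv_cancel_right]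

/-- The key theorem: the group generated by transvections meets the kernel in inner
automorphisms. -/
theorem tv_ker_inner [Fintype V] (hn : HasNoSIL G) {φ : MulAut (Raag G)}
    (hφ : φ ∈ TV G) (hab : abAut (Raag G) φ = 1) : φ ∈ Inn (Raag G) := by
  classical
  have main : ∀ S : Finset V, ∃ g : Raag G,
      (∀ s ∈ S, φ (gen G s) = MulAut.conj g (gen G s)) ∧
      (∀ s ∈ S, ∀ t, Bad G s t → φ (gen G t) = MulAut.conj g (gen G t)) ∧
      (∀ w, (∀ s ∈ S, ¬ Bad G s w) → (w ∈ S → ∀ t, ¬ Bad G w t) → Commute g (gen G w)) := by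
    intro S
    induction S using Finset.induction_on with
    | empty => exact ⟨1, by simp, by simp, fun w _ _ => Commute.one_left _⟩
    | insert u S huS ih =>
      obtain ⟨g, h1, h2, h3⟩ := ih
      by_cases ht : ∀ v, ¬ Bad G u v
      · refine ⟨g, ?_, ?_, ?_⟩
        · intro s hs
          rcases Finset.mem_insert.1 hs with rfl | hs
          · rw [tame_fixed hn hφ hab ht, conj_fix]
            exact h3 _ (fun t _ hb => ht t hb.symm) (fun _ => ht)
          · exact h1 s hs
        · intro s hs t hb
          rcases Finset.mem_insert.1 hs with rfl | hs
          · exact absurd hb (ht t)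
          · exact h2 s hs t hb
        · intro w hw hw'
          exact h3 w (fun s hs => hw s (Finset.mem_insert_of_mem hs))
            (fun hs => hw' (Finset.mem_insert_of_mem hs))
      push Not at ht
      obtain ⟨v, huv⟩ := ht
      have uniq : ∀ t, Bad G u t → t = v := by
        intro t ht
        by_contra hne
        exact ht.2.1 (huv.adj hn ht.1.symm hne)
      have uniq' : ∀ t, Bad G v t → t = u := by
        intro t ht
        by_contra hne
        exact ht.2.1 (huv.symm.adj hn ht.1.symm hne)
      by_cases hvS : v ∈ S
      · refine ⟨g, ?_, ?_, ?_⟩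
        · intro s hs
          rcases Finset.mem_insert.1 hs with rfl | hs
          · exact h2 v hvS _ huv.symm
          · exact h1 s hs
        · intro s hs t hb
          rcases Finset.mem_insert.1 hs with rfl | hs
          · rw [uniq t hb]; exact h1 v hvS
          · exact h2 s hs t hb
        · intro w hw hw'
          exact h3 w (fun s hs => hw s (Finset.mem_insert_of_mem hs))
            (fun hs => hw' (Finset.mem_insert_of_mem hs))
      obtain ⟨f, f1, f2⟩ := bad_conj hn huv hφ hab
      have gu : Commute g (gen G u) := h3 u
        (fun s hs hb => hvS (by rw [← uniq s hb.symm]; exact hs)) (fun h => absurd h huS)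
      have gv : Commute g (gen G v) := h3 v
        (fun s hs hb => huS (by rw [← uniq' s hb.symm]; exact hs)) (fun h => absurd h hvS)
      have fc : ∀ w, w ≠ u → w ≠ v → Commute (incl G u v f) (gen G w) := fun w hu hv =>
        incl_commute (huv.adj hn hu hv) (huv.symm.adj hn hv hu) f
      have eu : φ (gen G u) = MulAut.conj (incl G u v f * g) (gen G u) := by
        rw [map_mul, MulAut.mul_apply, conj_fix gu, f1]
      have ev : φ (gen G v) = MulAut.conj (incl G u v f * g) (gen G v) := by
        rw [map_mul, MulAut.mul_apply, conj_fix gv, f2]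
      have gf : Commute g (incl G u v f) := by
        clear f1 f2 fc eu ev
        induction f using f2_ind with
        | h1 => simp
        | hx => rw [incl_x]; exact gu
        | hy => rw [incl_y]; exact gv
        | hi g ih => rw [map_inv]; exact ih.inv_right
        | hm g k ih1 ih2 => rw [map_mul]; exact ih1.mul_right ih2
      have ew : ∀ w, w ≠ u → w ≠ v → φ (gen G w) = MulAut.conj g (gen G w) →
          φ (gen G w) = MulAut.conj (incl G u v f * g) (gen G w) := by
        intro w hu hv h
        rw [← gf.eq, map_mul, MulAut.mul_apply, conj_fix (fc w hu hv), h]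
      refine ⟨incl G u v f * g, ?_, ?_, ?_⟩
      · intro s hs
        rcases Finset.mem_insert.1 hs with rfl | hs
        · exact eu
        · exact ew s (fun e => huS (e ▸ hs)) (fun e => hvS (e ▸ hs)) (h1 s hs)
      · intro s hs t hb
        rcases Finset.mem_insert.1 hs with rfl | hs
        · rw [uniq t hb]; exact ev
        · by_cases t1 : t = u
          · subst t1; exact eu
          by_cases t2 : t = v
          · subst t2; exact ev
          exact ew t t1 t2 (h2 s hs t hb)
      · intro w hw hw'
        have w1 : w ≠ u := by
          rintro rfl
          exact hw' (Finset.mem_insert_self _ _) v huv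
        have w2 : w ≠ v := by
          rintro rfl
          exact hw u (Finset.mem_insert_self _ _) huv
        exact (fc w w1 w2).mul_left (h3 w (fun s hs => hw s (Finset.mem_insert_of_mem hs))
            (fun hs => hw' (Finset.mem_insert_of_mem hs)))
  obtain ⟨g, hg, -, -⟩ := main Finset.univ
  exact ⟨g, (raag_aut_ext fun v => hg v (Finset.mem_univ v)).symm⟩

lemma pc_ab {x : V} {C : Set V} {φ : MulAut (Raag G)} (h : IsPartialConj G x C φ) :
    abAut (Raag G) φ = 1 := by
  apply abAut_eq_one
  intro g
  have : (Abelianization.of : Raag G →* _).comp φ.toMonoidHom = Abelianization.of := by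
    apply raag_hom_ext
    intro v
    change Abelianization.of (φ (gen G v)) = _
    by_cases hv : v ∈ C
    · rw [h.1 v hv]
      simp [mul_comm]
    · rw [h.2 v hv]
  exact DFunLike.congr_fun this g

lemma tv_le : (TV G).map (toOut (Raag G)) ≤ SOut0 G := by
  rw [Subgroup.map_le_iff_le_comap]
  unfold TV
  rw [Subgroup.closure_le]
  rintro φ h
  exact Subgroup.subset_closure ⟨φ, rfl, Or.inl h⟩

lemma sout_rho (s : Out (Raag G)) (hs : s ∈ SOut0 G) :
    ∃ t ∈ TV G, rhoOut (Raag G) s = abAut (Raag G) t := by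
  unfold SOut0 at hs
  induction hs using Subgroup.closure_induction with
  | mem s hs =>
    obtain ⟨φ, rfl, h | ⟨x, C, -, h⟩⟩ := hs
    · exact ⟨φ, Subgroup.subset_closure h, rfl⟩
    · exact ⟨1, one_mem _, by rw [rhoOut_toOut, pc_ab h, map_one]⟩
  | one => exact ⟨1, one_mem _, by rw [map_one, map_one]⟩
  | mul x y _ _ hx hy =>
    obtain ⟨a, ha, e1⟩ := hx
    obtain ⟨b, hb, e2⟩ := hy
    exact ⟨a * b, mul_mem ha hb, by rw [map_mul, map_mul, e1, e2]⟩
  | inv x _ hx =>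
    obtain ⟨a, ha, e1⟩ := hx
    exact ⟨a⁻¹, inv_mem ha, by rw [map_inv, map_inv, e1]⟩

lemma tv_out_inj [Fintype V] (hn : HasNoSIL G) {a b : MulAut (Raag G)} (ha : a ∈ TV G)
    (hb : b ∈ TV G) (h : abAut (Raag G) a = abAut (Raag G) b) :
    toOut (Raag G) a = toOut (Raag G) b := by
  have : a⁻¹ * b ∈ Inn (Raag G) := by
    apply tv_ker_inner hn (mul_mem (inv_mem ha) hb)
    rw [map_mul, map_inv, h, inv_mul_cancel]
  exact QuotientGroup.eq.2 this

end RAAG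

end RaagPaper

open RaagPaper in
/-- If `Γ` has no SIL, the short exact sequence
`1 → ker ρ̄ → SOut⁰(A_Γ) → Q → 1` coming from the standard representation splits. -/
theorem statement16 {V : Type} [Fintype V] (G : SimpleGraph V)
    (hnosil : HasNoSIL G) :
    ∃ σ : ((rhoOut (Raag G)).comp (SOut0 G).subtype).range →* (SOut0 G),
      ∀ q : ((rhoOut (Raag G)).comp (SOut0 G).subtype).range,
        ((rhoOut (Raag G)).comp (SOut0 G).subtype) (σ q)
          = (q : MulAut (Abelianization (Raag G))) := by
  have hex : ∀ q : ((rhoOut (Raag G)).comp (SOut0 G).subtype).range,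
      ∃ t ∈ TV G, (q : MulAut (Abelianization (Raag G))) = abAut (Raag G) t := by
    rintro ⟨_, s, rfl⟩
    exact sout_rho s.1 s.2
  choose t ht hq using hex
  refine ⟨MonoidHom.mk' (fun q => ⟨toOut (Raag G) (t q),
    tv_le (Subgroup.mem_map_of_mem _ (ht q))⟩) ?_, ?_⟩
  · intro p q
    apply Subtype.ext
    change toOut (Raag G) (t (p * q)) = toOut (Raag G) (t p) * toOut (Raag G) (t q)
    rw [← map_mul]
    apply tv_out_inj hnosil (ht _) (mul_mem (ht _) (ht _))
    rw [← hq, map_mul, ← hq, ← hq]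
    rfl
  · intro q
    exact (hq q).symm
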